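/- arXiv:1804.02008 — 4 statements merged into one kernel-verified Lean document; each statement's English description precedes it below -/
import Mathlib

section
/- Let X ∈ 𝒞 be a global optimum of the SDP, and assume strong duality holds, i.e., there exists ν ∈ ℝ^m with C − 𝒜*(ν) positive semidefinite and ⟨b, ν⟩ = ⟨C, X⟩. Let p = rank(X) and let Y ∈ ℝ^{n×p} with X = YYᵀ, and assume A_1 Y, …, A_m Y are linearly independent. Then S = C − 𝒜*(G^{-1} 𝒜(CX)), where G_{ij} = ⟨A_i Y, A_j Y⟩ = trace(A_i A_j X), is positive semidefinite and satisfies ⟨S, X⟩ = 0. -/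
open Matrix MeasureTheory

noncomputable section

/-- Frobenius inner product ⟨A,B⟩ = trace(AᵀB). -/
def ip {n p : ℕ} (A B : Matrix (Fin n) (Fin p) ℝ) : ℝ := Matrix.trace (Aᵀ * B)

/-- The constraint map 𝒜(X)ᵢ = trace(Aᵢ X). -/
def calA {n m : ℕ} (A : Fin m → Matrix (Fin n) (Fin n) ℝ) (X : Matrix (Fin n) (Fin n) ℝ) :
    Fin m → ℝ := fun i => Matrix.trace (A i * X)

/-- The adjoint 𝒜*(ν) = ∑ νᵢ Aᵢ. -/
def adjA {n m : ℕ} (A : Fin m → Matrix (Fin n) (Fin n) ℝ) (ν : Fin m → ℝ) :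
    Matrix (Fin n) (Fin n) ℝ := ∑ i, ν i • A i

/-- ℳ_p = {Y ∈ ℝ^{n×p} : 𝒜(YYᵀ) = b}. -/
def MM {n m : ℕ} (A : Fin m → Matrix (Fin n) (Fin n) ℝ) (b : Fin m → ℝ) (p : ℕ) :
    Set (Matrix (Fin n) (Fin p) ℝ) := {Y | calA A (Y * Yᵀ) = b}

/-- 𝒞 = {X ∈ Sym(n,ℝ) : 𝒜(X) = b, X ⪰ 0}. -/
def CC {n m : ℕ} (A : Fin m → Matrix (Fin n) (Fin n) ℝ) (b : Fin m → ℝ) :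
    Set (Matrix (Fin n) (Fin n) ℝ) := {X | X.IsSymm ∧ calA A X = b ∧ X.PosSemidef}

/-- Gram matrix G(Y)ᵢⱼ = ⟨AᵢY, AⱼY⟩. -/
def gram {n m p : ℕ} (A : Fin m → Matrix (Fin n) (Fin n) ℝ) (Y : Matrix (Fin n) (Fin p) ℝ) :
    Matrix (Fin m) (Fin m) ℝ := Matrix.of fun i j => ip (A i * Y) (A j * Y)

/-- S(Y) = C − 𝒜*(G(Y)⁻¹ 𝒜(C Y Yᵀ)). -/
def Smat {n m p : ℕ} (A : Fin m → Matrix (Fin n) (Fin n) ℝ) (C : Matrix (Fin n) (Fin n) ℝ)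
    (Y : Matrix (Fin n) (Fin p) ℝ) : Matrix (Fin n) (Fin n) ℝ :=
  C - adjA A ((gram A Y)⁻¹ *ᵥ calA A (C * (Y * Yᵀ)))

/-- Frobenius norm. -/
def frob {a c : ℕ} (M : Matrix (Fin a) (Fin c) ℝ) : ℝ := Real.sqrt (∑ i, ∑ j, (M i j) ^ 2)


theorem calA_adjA_mul {n m p : ℕ} (A : Fin m → Matrix (Fin n) (Fin n) ℝ)
    (hA : ∀ i, (A i).IsSymm) (Y : Matrix (Fin n) (Fin p) ℝ) (ν : Fin m → ℝ) :
    calA A (adjA A ν * (Y * Yᵀ)) = gram A Y *ᵥ ν := by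
  funext i
  simp only [calA, adjA, _root_.gram, ip, mulVec, dotProduct, of_apply, Matrix.sum_mul, Matrix.mul_sum,
    trace_sum, smul_mul, Matrix.mul_smul, trace_smul, smul_eq_mul, transpose_mul, (hA i).eq]
  refine Finset.sum_congr rfl fun j _ => ?_
  rw [mul_comm (ν j), Matrix.mul_assoc Yᵀ, trace_mul_comm Yᵀ]
  simp only [Matrix.mul_assoc]

theorem dotProduct_gram_mulVec {n m p : ℕ} (A : Fin m → Matrix (Fin n) (Fin n) ℝ)
    (Y : Matrix (Fin n) (Fin p) ℝ) (v : Fin m → ℝ) :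
    v ⬝ᵥ (gram A Y *ᵥ v) = ip (∑ i, v i • (A i * Y)) (∑ i, v i • (A i * Y)) := by
  simp only [_root_.gram, ip, mulVec, dotProduct, of_apply, transpose_sum, transpose_smul,
    Matrix.sum_mul, Matrix.mul_sum, trace_sum, smul_mul, Matrix.mul_smul, trace_smul, smul_eq_mul,
    Finset.mul_sum]
  rw [Finset.sum_comm]
  exact Finset.sum_congr rfl fun i _ => Finset.sum_congr rfl fun j _ => by ring

theorem isUnit_det_gram {n m p : ℕ} (A : Fin m → Matrix (Fin n) (Fin n) ℝ)
    (Y : Matrix (Fin n) (Fin p) ℝ) (hli : LinearIndependent ℝ (fun i => A i * Y)) :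
    IsUnit (gram A Y).det := by
  rw [isUnit_iff_ne_zero]
  intro h
  obtain ⟨v, hv, hGv⟩ := exists_mulVec_eq_zero_iff.mpr h
  have h0 := dotProduct_gram_mulVec A Y v
  rw [hGv, dotProduct_zero, ip, ← conjTranspose_eq_transpose_of_trivial] at h0
  have hW := trace_conjTranspose_mul_self_eq_zero_iff.mp h0.symm
  exact hv (funext (Fintype.linearIndependent_iff.mp hli v hW))

open scoped MatrixOrder Matrix.Norms.L2Operator in
theorem Matrix.PosSemidef.mul_eq_zero_of_trace_eq_zero {n p : ℕ} {Z : Matrix (Fin n) (Fin n) ℝ}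
    (hZ : Z.PosSemidef) (Y : Matrix (Fin n) (Fin p) ℝ) (h : trace (Z * (Y * Yᵀ)) = 0) :
    Z * Y = 0 := by
  obtain ⟨B, rfl⟩ := CStarAlgebra.nonneg_iff_eq_star_mul_self.mp hZ.nonneg
  rw [star_eq_conjTranspose] at h ⊢
  have hBY : trace ((B * Y)ᴴ * (B * Y)) = 0 := by
    rw [← h, ← Matrix.mul_assoc _ Y, trace_mul_comm _ Yᵀ, conjTranspose_mul,
      conjTranspose_eq_transpose_of_trivial Y]
    simp only [Matrix.mul_assoc]
  rw [Matrix.mul_assoc, trace_conjTranspose_mul_self_eq_zero_iff.mp hBY, Matrix.mul_zero]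

theorem trace_adjA_mul {n m : ℕ} (A : Fin m → Matrix (Fin n) (Fin n) ℝ) (ν : Fin m → ℝ)
    (X : Matrix (Fin n) (Fin n) ℝ) : trace (adjA A ν * X) = ∑ i, calA A X i * ν i := by
  simp only [adjA, calA, Matrix.sum_mul, trace_sum, smul_mul, trace_smul, smul_eq_mul, mul_comm]

/-- Proposition 7 of the paper: if X is a global optimum of the SDP,
strong duality holds, and Assumption 1a holds at p = rank X, then
S = C − 𝒜*(G⁻¹𝒜(CX)) is positive semidefinite and ⟨S, X⟩ = 0. -/
theorem stmt6 (n m : ℕ) (hn : 1 ≤ n) (hm : 1 ≤ m)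
    (A : Fin m → Matrix (Fin n) (Fin n) ℝ) (hA : ∀ i, (A i).IsSymm)
    (C : Matrix (Fin n) (Fin n) ℝ) (hC : C.IsSymm) (b : Fin m → ℝ)
    (X : Matrix (Fin n) (Fin n) ℝ) (hX : X ∈ CC A b)
    (hopt : ∀ X' ∈ CC A b, Matrix.trace (Cᵀ * X) ≤ Matrix.trace (Cᵀ * X'))
    (ν : Fin m → ℝ) (hdualpsd : (C - adjA A ν).PosSemidef)
    (hdualval : ∑ i, b i * ν i = Matrix.trace (Cᵀ * X))
    (p : ℕ) (hp : p = X.rank)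
    (Y : Matrix (Fin n) (Fin p) ℝ) (hYX : X = Y * Yᵀ)
    (hli : LinearIndependent ℝ (fun i => A i * Y)) :
    (C - adjA A ((gram A Y)⁻¹ *ᵥ calA A (C * X))).PosSemidef ∧
    Matrix.trace ((C - adjA A ((gram A Y)⁻¹ *ᵥ calA A (C * X)))ᵀ * X) = 0 := by
  have hZX : trace ((C - adjA A ν) * X) = 0 := by
    rw [Matrix.sub_mul, trace_sub, trace_adjA_mul, hX.2.1, hdualval, hC.eq, sub_self]
  have hZY : (C - adjA A ν) * Y = 0 :=
    hdualpsd.mul_eq_zero_of_trace_eq_zero Y (hYX ▸ hZX)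
  have hCX : C * X = adjA A ν * (Y * Yᵀ) := by
    rw [Matrix.sub_mul, sub_eq_zero] at hZY
    rw [hYX, ← Matrix.mul_assoc, hZY, Matrix.mul_assoc]
  have hν : (gram A Y)⁻¹ *ᵥ calA A (C * X) = ν := by
    rw [hCX, calA_adjA_mul A hA, mulVec_mulVec, nonsing_inv_mul _ (isUnit_det_gram A Y hli),
      one_mulVec]
  rw [hν]
  refine ⟨hdualpsd, ?_⟩
  rwa [← conjTranspose_eq_transpose_of_trivial, hdualpsd.isHermitian.eq]
end
end

section
/- Let p ≥ n, and assume that for every Y ∈ ℳ_p the matrices A_1 Y, …, A_m Y are linearly independent. Then every second-order critical point Y ∈ ℳ_p (i.e., S(Y)Y = 0 and ⟨Ẏ, S(Y)Ẏ⟩ ≥ 0 for all Ẏ with ⟨A_i Y, Ẏ⟩ = 0 for all i) is globally optimal for the factorized problem, and X = YYᵀ is globally optimal for the SDP. -/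
open Matrix MeasureTheory

noncomputable section

/-- A matrix with nonnegative quadratic form has nonnegative trace pairing with every positive
semidefinite matrix. -/
theorem trace_mul_nonneg_of_quadratic_nonneg {n : ℕ} {S X : Matrix (Fin n) (Fin n) ℝ}
    (hS : ∀ x : Fin n → ℝ, 0 ≤ x ⬝ᵥ S *ᵥ x) (hX : X.PosSemidef) : 0 ≤ trace (S * X) := by
  obtain ⟨B, rfl⟩ : ∃ B : Matrix (Fin n) (Fin n) ℝ, X = Bᴴ * B := by
    open scoped MatrixOrder in
    exact CStarAlgebra.nonneg_iff_eq_star_mul_self.mp hX.nonneg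
  rw [← Matrix.mul_assoc, trace_mul_comm]
  refine Finset.sum_nonneg fun i _ => ?_
  have h : (B * (S * Bᴴ)) i i = B i ⬝ᵥ S *ᵥ B i := by
    simp [Matrix.mul_apply, dotProduct, mulVec]
  rw [diag_apply, h]
  exact hS (B i)

/-- If `S` is nonnegative on the directions orthogonal to all `A i * Y` and `S * Y = 0`, then `S` has
nonnegative quadratic form: either `Y` has a kernel vector `z ≠ 0`, and the directions `x zᵀ` are
admissible, or `Y` is square and invertible, and `S = 0`. -/
theorem quadratic_nonneg_of_second_order {n m p : ℕ} (hpn : n ≤ p)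
    (A : Fin m → Matrix (Fin n) (Fin n) ℝ) {S : Matrix (Fin n) (Fin n) ℝ}
    {Y : Matrix (Fin n) (Fin p) ℝ} (hSY : S * Y = 0)
    (hsoc : ∀ V : Matrix (Fin n) (Fin p) ℝ, (∀ i, ip (A i * Y) V = 0) → 0 ≤ ip V (S * V))
    (x : Fin n → ℝ) : 0 ≤ x ⬝ᵥ S *ᵥ x := by
  by_cases hz : ∃ z : Fin p → ℝ, z ≠ 0 ∧ Y *ᵥ z = 0
  · obtain ⟨z, hz0, hYz⟩ := hz
    have htangent : ∀ i, ip (A i * Y) (vecMulVec x z) = 0 := fun i => by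
      rw [ip, mul_vecMulVec, trace_vecMulVec, mulVec_transpose, ← dotProduct_mulVec,
        ← mulVec_mulVec, hYz, mulVec_zero, dotProduct_zero]
    have h := hsoc (vecMulVec x z) htangent
    have hval : ip (vecMulVec x z) (S * vecMulVec x z) = (z ⬝ᵥ z) * (x ⬝ᵥ S *ᵥ x) := by
      rw [ip, mul_vecMulVec, transpose_vecMulVec, vecMulVec_mul_vecMulVec, trace_vecMulVec]
      simp [mul_comm]
    rw [hval] at h
    have hpos : 0 < z ⬝ᵥ z :=
      lt_of_le_of_ne (Finset.sum_nonneg fun i _ => mul_self_nonneg (z i))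
        fun h0 => hz0 (dotProduct_self_eq_zero.mp h0.symm)
    exact nonneg_of_mul_nonneg_right h hpos
  · have hinj : Function.Injective Y.mulVecLin := by
      refine (injective_iff_map_eq_zero _).mpr fun z hYz => ?_
      by_contra hz0
      exact hz ⟨z, hz0, hYz⟩
    have hle := LinearMap.finrank_le_finrank_of_injective hinj
    simp only [Module.finrank_fin_fun] at hle
    obtain rfl : n = p := le_antisymm hpn hle
    have hunit : IsUnit Y := mulVec_injective_iff_isUnit.mp hinj
    have hS : S = 0 := (hunit.mul_left_eq_zero).mp hSY
    simp [hS]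

/-- Pairing `C - 𝒜*(ν)` with a feasible matrix shifts the objective by a constant. -/
theorem trace_sub_adjA_mul {n m : ℕ} (A : Fin m → Matrix (Fin n) (Fin n) ℝ)
    (C X : Matrix (Fin n) (Fin n) ℝ) (ν : Fin m → ℝ) :
    trace ((C - adjA A ν) * X) = trace (C * X) - ν ⬝ᵥ calA A X := by
  simp [adjA, calA, Matrix.sub_mul, Matrix.sum_mul, trace_sum, dotProduct]

theorem ip_mul_self {n p : ℕ} (C : Matrix (Fin n) (Fin n) ℝ) (Y : Matrix (Fin n) (Fin p) ℝ) :
    ip (C * Y) Y = trace (Cᵀ * (Y * Yᵀ)) := by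
  rw [ip, transpose_mul, Matrix.mul_assoc, trace_mul_comm, Matrix.mul_assoc]

/-- Corollary 3 of the paper: if p ≥ n and Assumption 1a holds at p,
then every second-order critical point of the factorized problem is globally optimal,
and X = YYᵀ is globally optimal for the SDP. -/
theorem stmt8 (n m p : ℕ) (hn : 1 ≤ n) (hm : 1 ≤ m) (hpn : n ≤ p)
    (A : Fin m → Matrix (Fin n) (Fin n) ℝ) (hA : ∀ i, (A i).IsSymm)
    (C : Matrix (Fin n) (Fin n) ℝ) (hC : C.IsSymm) (b : Fin m → ℝ)
    (hli : ∀ Y ∈ MM A b p, LinearIndependent ℝ (fun i => A i * Y))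
    (Y : Matrix (Fin n) (Fin p) ℝ) (hY : Y ∈ MM A b p)
    (hcrit : Smat A C Y * Y = 0)
    (hsoc : ∀ V : Matrix (Fin n) (Fin p) ℝ, (∀ i, ip (A i * Y) V = 0) →
      0 ≤ ip V (Smat A C Y * V)) :
    (∀ Y' ∈ MM A b p, ip (C * Y) Y ≤ ip (C * Y') Y') ∧
    (∀ X' ∈ CC A b, Matrix.trace (Cᵀ * (Y * Yᵀ)) ≤ Matrix.trace (Cᵀ * X')) := by
  have hS := quadratic_nonneg_of_second_order hpn A hcrit hsoc
  have hopt : ∀ X', calA A X' = b → X'.PosSemidef →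
      trace (Cᵀ * (Y * Yᵀ)) ≤ trace (Cᵀ * X') := fun X' hX' hpos => by
    have hnonneg := trace_mul_nonneg_of_quadratic_nonneg hS hpos
    have hzero : trace (Smat A C Y * (Y * Yᵀ)) = 0 := by
      rw [← Matrix.mul_assoc, hcrit, Matrix.zero_mul, trace_zero]
    rw [Smat, trace_sub_adjA_mul] at hnonneg hzero
    rw [hX'] at hnonneg
    rw [show calA A (Y * Yᵀ) = b from hY] at hzero
    rw [hC.eq]
    linarith
  refine ⟨fun Y' hY' => ?_, fun X' hX' => hopt X' hX'.2.1 hX'.2.2⟩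
  rw [ip_mul_self, ip_mul_self]
  exact hopt _ hY' (by simpa using posSemidef_self_mul_conjTranspose Y')
end
end

section
/- Assume that for every Y ∈ ℳ_p the matrices A_1 Y, …, A_m Y are linearly independent. Let Y ∈ ℳ_p be a second-order critical point (S(Y)Y = 0 and ⟨Ẏ, S(Y)Ẏ⟩ ≥ 0 for all Ẏ with ⟨A_i Y, Ẏ⟩ = 0 for all i) with rank(Y) = p. Let k be the dimension of the subspace {A ∈ Sym(p,ℝ) : 𝒜(Y A Yᵀ) = 0} and let Δ = p(p+1)/2 − m. Then the number of negative eigenvalues of S(Y), counted with multiplicity, is at most ⌊(k − Δ)/p⌋. -/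
open Matrix MeasureTheory

noncomputable section

/-- The subspace {A ∈ Sym(p,ℝ) : 𝒜(Y A Yᵀ) = 0}, whose dimension is the dimension of
the face of 𝒞 containing X = YYᵀ in its relative interior. -/
def faceSpace {n m p : ℕ} (A : Fin m → Matrix (Fin n) (Fin n) ℝ)
    (Y : Matrix (Fin n) (Fin p) ℝ) : Submodule ℝ (Matrix (Fin p) (Fin p) ℝ) where
  carrier := {B | B.IsSymm ∧ ∀ i, Matrix.trace (A i * (Y * B * Yᵀ)) = 0}
  add_mem' := by
    rintro B C ⟨hB1, hB2⟩ ⟨hC1, hC2⟩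
    refine ⟨?_, fun i => ?_⟩
    · simp [Matrix.IsSymm, Matrix.transpose_add, hB1.eq, hC1.eq]
    · simp [Matrix.mul_add, Matrix.add_mul, hB2 i, hC2 i]
  zero_mem' := by
    refine ⟨?_, fun i => ?_⟩ <;> simp [Matrix.IsSymm]
  smul_mem' := by
    rintro c B ⟨hB1, hB2⟩
    refine ⟨?_, fun i => ?_⟩
    · simp [Matrix.IsSymm, Matrix.transpose_smul, hB1.eq]
    · simp [Matrix.mul_smul, Matrix.smul_mul, hB2 i]

/-- The symmetric matrix whose entries are given by a function on unordered pairs. -/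
def symMatrix (p : ℕ) : (Sym2 (Fin p) → ℝ) →ₗ[ℝ] Matrix (Fin p) (Fin p) ℝ where
  toFun f := Matrix.of fun i j => f s(i, j)
  map_add' _ _ := rfl
  map_smul' _ _ := rfl

lemma symMatrix_isSymm {p : ℕ} (f : Sym2 (Fin p) → ℝ) : (symMatrix p f).IsSymm := by
  ext i j
  exact congrArg f Sym2.eq_swap

lemma symMatrix_injective (p : ℕ) : Function.Injective (symMatrix p) := by
  intro f g h
  funext z
  induction z with
  | h i j => exact congrFun (congrFun h i) j

/-- `V ↦ ⟨M, V⟩` as a linear map. -/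
def ipLin {n p : ℕ} (M : Matrix (Fin n) (Fin p) ℝ) : Matrix (Fin n) (Fin p) ℝ →ₗ[ℝ] ℝ where
  toFun V := ip M V
  map_add' _ _ := by simp [ip, Matrix.mul_add]
  map_smul' _ _ := by simp [ip]

lemma ip_mul_mul_eq_trace {n p : ℕ} {M : Matrix (Fin n) (Fin n) ℝ} (hM : M.IsSymm)
    (Y : Matrix (Fin n) (Fin p) ℝ) (B : Matrix (Fin p) (Fin p) ℝ) :
    ip (M * Y) (Y * B) = Matrix.trace (M * (Y * B * Yᵀ)) := by
  rw [ip, Matrix.transpose_mul, hM.eq, ← Matrix.mul_assoc M, Matrix.trace_mul_comm _ Yᵀ,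
    Matrix.mul_assoc]

/-- The columns are the orthonormal eigenvectors of `S` with negative eigenvalue. -/
def negEigvecs {n : ℕ} {S : Matrix (Fin n) (Fin n) ℝ} (hS : S.IsHermitian) :
    Matrix (Fin n) {j // hS.eigenvalues j < 0} ℝ :=
  Matrix.of fun i j => hS.eigenvectorBasis j.1 i

lemma negEigvecs_transpose_mul_self {n : ℕ} {S : Matrix (Fin n) (Fin n) ℝ} (hS : S.IsHermitian) :
    (negEigvecs hS)ᵀ * negEigvecs hS = 1 := by
  ext i j
  have h := orthonormal_iff_ite.mp hS.eigenvectorBasis.orthonormal i.1 j.1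
  simpa [negEigvecs, Matrix.mul_apply, Matrix.one_apply, PiLp.inner_apply, mul_comm,
    Subtype.ext_iff] using h

lemma mul_negEigvecs {n : ℕ} {S : Matrix (Fin n) (Fin n) ℝ} (hS : S.IsHermitian) :
    S * negEigvecs hS = negEigvecs hS *
      (Matrix.diagonal fun j => hS.eigenvalues j.1 : Matrix {j // hS.eigenvalues j < 0} _ ℝ) := by
  ext i j
  have h := congrFun (hS.mulVec_eigenvectorBasis j.1) i
  rw [Matrix.mul_diagonal]
  simpa [negEigvecs, Matrix.mul_apply, Matrix.mulVec, dotProduct, mul_comm] using h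

lemma ip_negEigvecs_mul {n p : ℕ} {S : Matrix (Fin n) (Fin n) ℝ} (hS : S.IsHermitian)
    (R : Matrix {j // hS.eigenvalues j < 0} (Fin p) ℝ) :
    ip (negEigvecs hS * R) (S * (negEigvecs hS * R)) =
      ∑ a, ∑ j : {j // hS.eigenvalues j < 0}, hS.eigenvalues j.1 * R j a ^ 2 := by
  rw [ip, ← Matrix.mul_assoc S, mul_negEigvecs, Matrix.transpose_mul, Matrix.mul_assoc Rᵀ,
    Matrix.mul_assoc (negEigvecs hS), ← Matrix.mul_assoc (negEigvecs hS)ᵀ,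
    negEigvecs_transpose_mul_self, Matrix.one_mul]
  refine Finset.sum_congr rfl fun a _ => ?_
  rw [Matrix.diag_apply, Matrix.mul_apply]
  refine Finset.sum_congr rfl fun j _ => ?_
  rw [Matrix.diagonal_mul, Matrix.transpose_apply]
  ring

lemma eq_zero_of_ip_negEigvecs_mul_nonneg {n p : ℕ} {S : Matrix (Fin n) (Fin n) ℝ}
    (hS : S.IsHermitian) (R : Matrix {j // hS.eigenvalues j < 0} (Fin p) ℝ)
    (h : 0 ≤ ip (negEigvecs hS * R) (S * (negEigvecs hS * R))) : R = 0 := by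
  rw [ip_negEigvecs_mul] at h
  have hle (a : Fin p) (j : {j // hS.eigenvalues j < 0}) :
      hS.eigenvalues j.1 * R j a ^ 2 ≤ 0 :=
    mul_nonpos_of_nonpos_of_nonneg j.2.le (sq_nonneg _)
  have hsum (a : Fin p) : ∑ j : {j // hS.eigenvalues j < 0}, hS.eigenvalues j.1 * R j a ^ 2 ≤ 0 :=
    Finset.sum_nonpos fun j _ => hle a j
  have h0 := le_antisymm (Finset.sum_nonpos fun a _ => hsum a) h
  ext j a
  have ha := (Finset.sum_eq_zero_iff_of_nonpos fun a _ => hsum a).mp h0 a (Finset.mem_univ a)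
  have hj := (Finset.sum_eq_zero_iff_of_nonpos fun j _ => hle a j).mp ha j (Finset.mem_univ j)
  simpa [j.2.ne] using hj

lemma ip_add_mul_self {n p : ℕ} {S : Matrix (Fin n) (Fin n) ℝ} (hS : S.IsHermitian)
    {W : Matrix (Fin n) (Fin p) ℝ} (hW : S * W = 0) (Z : Matrix (Fin n) (Fin p) ℝ) :
    ip (W + Z) (S * (W + Z)) = ip Z (S * Z) := by
  have hW' : Wᵀ * S = 0 := by
    have hT : Sᵀ = S := by simpa [Matrix.IsHermitian] using hS
    simpa [hT] using congrArg Matrix.transpose hW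
  rw [Matrix.mul_add, hW, zero_add, ip, ip, Matrix.transpose_add, Matrix.add_mul,
    ← Matrix.mul_assoc, hW', Matrix.zero_mul, zero_add]

/-- The constraint differentials `⟨AᵢY, YB + UR⟩`, where `B` is symmetric and the columns of `U`
are the negative eigenvectors of `S`. -/
def tangentConstraint {n m p : ℕ} (A : Fin m → Matrix (Fin n) (Fin n) ℝ)
    (Y : Matrix (Fin n) (Fin p) ℝ) {S : Matrix (Fin n) (Fin n) ℝ} (hS : S.IsHermitian) :
    ((Sym2 (Fin p) → ℝ) × Matrix {j // hS.eigenvalues j < 0} (Fin p) ℝ) →ₗ[ℝ] (Fin m → ℝ) :=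
  LinearMap.pi fun i => ipLin (A i * Y) ∘ₗ
    (mulLeftLinearMap (Fin p) ℝ Y ∘ₗ symMatrix p).coprod
      (mulLeftLinearMap (Fin p) ℝ (negEigvecs hS))

lemma tangentConstraint_apply {n m p : ℕ} (A : Fin m → Matrix (Fin n) (Fin n) ℝ)
    (Y : Matrix (Fin n) (Fin p) ℝ) {S : Matrix (Fin n) (Fin n) ℝ} (hS : S.IsHermitian)
    (x : (Sym2 (Fin p) → ℝ) × Matrix {j // hS.eigenvalues j < 0} (Fin p) ℝ) (i : Fin m) :
    tangentConstraint A Y hS x i = ip (A i * Y) (Y * symMatrix p x.1 + negEigvecs hS * x.2) :=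
  rfl

lemma finrank_ker_tangentConstraint_le {n m p : ℕ} {A : Fin m → Matrix (Fin n) (Fin n) ℝ}
    (hA : ∀ i, (A i).IsSymm) {Y : Matrix (Fin n) (Fin p) ℝ} {S : Matrix (Fin n) (Fin n) ℝ}
    (hS : S.IsHermitian) (hcrit : S * Y = 0)
    (hsoc : ∀ V : Matrix (Fin n) (Fin p) ℝ, (∀ i, ip (A i * Y) V = 0) → 0 ≤ ip V (S * V)) :
    Module.finrank ℝ (LinearMap.ker (tangentConstraint A Y hS)) ≤
      Module.finrank ℝ (faceSpace A Y) := by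
  have hsnd (x) (hx : x ∈ LinearMap.ker (tangentConstraint A Y hS)) : x.2 = 0 := by
    have h := hsoc (Y * symMatrix p x.1 + negEigvecs hS * x.2) fun i => congrFun hx i
    rw [ip_add_mul_self hS (by rw [← Matrix.mul_assoc, hcrit, Matrix.zero_mul])] at h
    exact eq_zero_of_ip_negEigvecs_mul_nonneg hS _ h
  have hmem (x : LinearMap.ker (tangentConstraint A Y hS)) :
      (symMatrix p ∘ₗ LinearMap.fst ℝ _ _ ∘ₗ Submodule.subtype _) x ∈ faceSpace A Y := by
    refine ⟨symMatrix_isSymm _, fun i => ?_⟩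
    have h := congrFun x.2 i
    rw [tangentConstraint_apply, hsnd x.1 x.2, Matrix.mul_zero, add_zero,
      ip_mul_mul_eq_trace (hA i)] at h
    exact h
  refine LinearMap.finrank_le_finrank_of_injective (f := LinearMap.codRestrict _ _ hmem) ?_
  intro x y h
  have h1 := symMatrix_injective p (congrArg Subtype.val h)
  exact Subtype.ext (Prod.ext h1 ((hsnd _ x.2).trans (hsnd _ y.2).symm))

lemma choose_add_card_mul_le {n m p : ℕ} {A : Fin m → Matrix (Fin n) (Fin n) ℝ}
    (hA : ∀ i, (A i).IsSymm) {Y : Matrix (Fin n) (Fin p) ℝ} {S : Matrix (Fin n) (Fin n) ℝ}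
    (hS : S.IsHermitian) (hcrit : S * Y = 0)
    (hsoc : ∀ V : Matrix (Fin n) (Fin p) ℝ, (∀ i, ip (A i * Y) V = 0) → 0 ≤ ip V (S * V)) :
    (p + 1).choose 2 + (Finset.univ.filter fun j => hS.eigenvalues j < 0).card * p ≤
      m + Module.finrank ℝ (faceSpace A Y) := by
  have hker := finrank_ker_tangentConstraint_le hA hS hcrit hsoc
  have hrange := (LinearMap.range (tangentConstraint A Y hS)).finrank_le
  have hrn := (tangentConstraint A Y hS).finrank_range_add_finrank_ker
  rw [Module.finrank_prod, Module.finrank_fintype_fun_eq_card, Sym2.card, Module.finrank_matrix,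
    Fintype.card_subtype] at hrn
  simp only [Module.finrank_fintype_fun_eq_card, Module.finrank_self, Fintype.card_fin,
    mul_one] at hrange hrn
  omega

/-- Theorem 4 of the paper: at a full-rank second-order critical point Y,
the number of negative eigenvalues of S(Y) is at most ⌊(dim 𝓕_X − Δ)/p⌋ with
Δ = p(p+1)/2 − m. -/
theorem stmt11 (n m p : ℕ) (hn : 1 ≤ n) (hm : 1 ≤ m) (hp : 1 ≤ p)
    (A : Fin m → Matrix (Fin n) (Fin n) ℝ) (hA : ∀ i, (A i).IsSymm)
    (C : Matrix (Fin n) (Fin n) ℝ) (hC : C.IsSymm) (b : Fin m → ℝ)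
    (hli : ∀ Y ∈ MM A b p, LinearIndependent ℝ (fun i => A i * Y))
    (Y : Matrix (Fin n) (Fin p) ℝ) (hY : Y ∈ MM A b p) (hrk : Y.rank = p)
    (hcrit : Smat A C Y * Y = 0)
    (hsoc : ∀ V : Matrix (Fin n) (Fin p) ℝ, (∀ i, ip (A i * Y) V = 0) →
      0 ≤ ip V (Smat A C Y * V))
    (hS : (Smat A C Y).IsHermitian) :
    ((Finset.univ.filter fun j => hS.eigenvalues j < 0).card : ℤ) ≤
      ⌊((Module.finrank ℝ (faceSpace A Y) : ℝ) - ((p * (p + 1) : ℝ) / 2 - m)) / p⌋ := by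
  have h := choose_add_card_mul_le hA hS hcrit hsoc
  have hR : ((p + 1).choose 2 : ℝ) +
      (Finset.univ.filter fun j => hS.eigenvalues j < 0).card * p ≤
        m + Module.finrank ℝ (faceSpace A Y) := by exact_mod_cast h
  rw [Nat.cast_choose_two] at hR
  push_cast at hR
  have hp0 : (0 : ℝ) < p := by exact_mod_cast hp
  rw [Int.le_floor, le_div_iff₀ hp0]
  push_cast
  linarith
end
end

section
/- Let p = n + 1 and assume that for every Y ∈ ℳ_{n+1} the matrices A_1 Y, …, A_m Y are linearly independent. Let R ≥ 0 be such that trace(X) ≤ R for every X ∈ 𝒞. Let Y ∈ ℳ_{n+1} and ε_g, ε_H ≥ 0 satisfy ‖2 S(Y) Y‖ ≤ ε_g and 2⟨Ẏ, S(Y) Ẏ⟩ ≥ −ε_H ‖Ẏ‖² for all Ẏ ∈ ℝ^{n×(n+1)} with ⟨A_i Y, Ẏ⟩ = 0 for all i. Then for every X' ∈ 𝒞, 2(⟨C, YYᵀ⟩ − ⟨C, X'⟩) ≤ ε_g √R + ε_H R. -/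
open Matrix MeasureTheory

noncomputable section

theorem frob_sq {a c : ℕ} (M : Matrix (Fin a) (Fin c) ℝ) : frob M ^ 2 = ∑ i, ∑ j, M i j ^ 2 :=
  Real.sq_sqrt (by positivity)

theorem ip_eq_sum {n p : ℕ} (M N : Matrix (Fin n) (Fin p) ℝ) :
    ip M N = ∑ i, ∑ j, M i j * N i j := by
  simp only [ip, trace, diag_apply, mul_apply, transpose_apply]
  exact Finset.sum_comm

theorem ip_le_frob_mul_frob {n p : ℕ} (M N : Matrix (Fin n) (Fin p) ℝ) :
    ip M N ≤ frob M * frob N := by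
  simp only [ip_eq_sum, frob, ← Fintype.sum_prod_type']
  exact Real.sum_mul_le_sqrt_mul_sqrt _ _ _

theorem frob_eq_sqrt_trace {n p : ℕ} (Y : Matrix (Fin n) (Fin p) ℝ) :
    frob Y = Real.sqrt (trace (Y * Yᵀ)) := by
  simp only [frob, trace, diag_apply, mul_apply, transpose_apply, sq]

theorem frob_vecMulVec_sq {n p : ℕ} (u : Fin n → ℝ) (z : Fin p → ℝ) :
    frob (vecMulVec u z) ^ 2 = (u ⬝ᵥ u) * (z ⬝ᵥ z) := by
  simp only [frob_sq, vecMulVec_apply, dotProduct, Finset.sum_mul_sum]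
  exact Finset.sum_congr rfl fun i _ => Finset.sum_congr rfl fun j _ => by ring

theorem ip_vecMulVec {n p : ℕ} (M : Matrix (Fin n) (Fin p) ℝ) (u : Fin n → ℝ) (z : Fin p → ℝ) :
    ip M (vecMulVec u z) = u ⬝ᵥ M *ᵥ z := by
  simp only [ip_eq_sum, vecMulVec_apply, dotProduct, mulVec, Finset.mul_sum]
  exact Finset.sum_congr rfl fun i _ => Finset.sum_congr rfl fun j _ => by ring

/-- A wide matrix has a nontrivial kernel. -/
theorem exists_ne_zero_mulVec_eq_zero {n : ℕ} (Y : Matrix (Fin n) (Fin (n + 1)) ℝ) :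
    ∃ z : Fin (n + 1) → ℝ, z ≠ 0 ∧ Y *ᵥ z = 0 := by
  have h : LinearMap.ker Y.mulVecLin ≠ ⊥ := LinearMap.ker_ne_bot_of_finrank_lt (by simp)
  obtain ⟨z, hz, hz0⟩ := Submodule.exists_mem_ne_zero_of_ne_bot h
  exact ⟨z, hz0, hz⟩

theorem trace_mul_eq_of_calA_eq {n m : ℕ} {A : Fin m → Matrix (Fin n) (Fin n) ℝ}
    {X X' : Matrix (Fin n) (Fin n) ℝ} (h : calA A X = calA A X') (ν : Fin m → ℝ) :
    trace (adjA A ν * X) = trace (adjA A ν * X') := by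
  simp only [adjA, Finset.sum_mul, trace_sum, smul_mul, trace_smul]
  exact Finset.sum_congr rfl fun i _ => congrArg (ν i • ·) (congrFun h i)

open scoped MatrixOrder Matrix.Norms.L2Operator in
/-- A lower bound on the quadratic form of `S` passes to its pairing with a positive
semidefinite matrix. -/
theorem neg_mul_trace_le_trace_mul {n : ℕ} {S X : Matrix (Fin n) (Fin n) ℝ} {c : ℝ}
    (hS : ∀ u, -c * (u ⬝ᵥ u) ≤ 2 * (u ⬝ᵥ S *ᵥ u)) (hX : X.PosSemidef) :
    -c * trace X ≤ 2 * trace (S * X) := by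
  obtain ⟨B, rfl⟩ := CStarAlgebra.nonneg_iff_eq_star_mul_self.mp hX.nonneg
  rw [star_eq_conjTranspose, conjTranspose_eq_transpose_of_trivial, ← Matrix.mul_assoc,
    trace_mul_comm (S * Bᵀ), trace_mul_comm Bᵀ]
  simp only [trace, diag_apply, Finset.mul_sum]
  exact Finset.sum_le_sum fun k _ => hS (B k)

/-- Where `Y` is rank deficient, the Hessian bound holds in every direction. -/
theorem quadratic_form_bound_of_mulVec_eq_zero {n m p : ℕ}
    {A : Fin m → Matrix (Fin n) (Fin n) ℝ} {S : Matrix (Fin n) (Fin n) ℝ}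
    {Y : Matrix (Fin n) (Fin p) ℝ} {c : ℝ} {z : Fin p → ℝ} (hz : z ≠ 0) (hYz : Y *ᵥ z = 0)
    (hhess : ∀ V : Matrix (Fin n) (Fin p) ℝ, (∀ i, ip (A i * Y) V = 0) →
      -c * frob V ^ 2 ≤ 2 * ip V (S * V)) (u : Fin n → ℝ) :
    -c * (u ⬝ᵥ u) ≤ 2 * (u ⬝ᵥ S *ᵥ u) := by
  have hzz : 0 < z ⬝ᵥ z := by simpa using dotProduct_star_self_pos_iff.2 hz
  have h := hhess (vecMulVec u z) fun i => by
    rw [ip_vecMulVec, ← mulVec_mulVec, hYz, mulVec_zero, dotProduct_zero]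
  rw [frob_vecMulVec_sq, mul_vecMulVec, ip_vecMulVec, vecMulVec_mulVec] at h
  simp only [dotProduct_smul, op_smul_eq_smul, smul_eq_mul, dotProduct_comm _ u] at h
  rw [← mul_assoc] at h
  refine le_of_mul_le_mul_right (h.trans_eq ?_) hzz
  rw [dotProduct_comm u]
  ring

/-- Corollary 5 of the paper: for p = n + 1, an approximate second-order
critical point Y ∈ ℳ_{n+1} is approximately optimal:
2(⟨C, YYᵀ⟩ − ⟨C, X'⟩) ≤ ε_g √R + ε_H R for all X' ∈ 𝒞. -/
theorem stmt16 (n m : ℕ) (hn : 1 ≤ n) (hm : 1 ≤ m)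
    (A : Fin m → Matrix (Fin n) (Fin n) ℝ) (hA : ∀ i, (A i).IsSymm)
    (C : Matrix (Fin n) (Fin n) ℝ) (hC : C.IsSymm) (b : Fin m → ℝ)
    (hli : ∀ Y ∈ MM A b (n + 1), LinearIndependent ℝ (fun i => A i * Y))
    (R : ℝ) (hR : 0 ≤ R) (hRC : ∀ X ∈ CC A b, Matrix.trace X ≤ R)
    (Y : Matrix (Fin n) (Fin (n + 1)) ℝ) (hY : Y ∈ MM A b (n + 1))
    (εg εH : ℝ) (hεg : 0 ≤ εg) (hεH : 0 ≤ εH)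
    (hgrad : frob (2 • (Smat A C Y * Y)) ≤ εg)
    (hhess : ∀ V : Matrix (Fin n) (Fin (n + 1)) ℝ, (∀ i, ip (A i * Y) V = 0) →
      -εH * frob V ^ 2 ≤ 2 * ip V (Smat A C Y * V)) :
    ∀ X' ∈ CC A b,
      2 * (Matrix.trace (Cᵀ * (Y * Yᵀ)) - Matrix.trace (Cᵀ * X')) ≤
        εg * Real.sqrt R + εH * R := by
  intro X' hX'
  obtain ⟨z, hz, hYz⟩ := exists_ne_zero_mulVec_eq_zero Y
  have hpsd := neg_mul_trace_le_trace_mul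
    (quadratic_form_bound_of_mulVec_eq_zero hz hYz hhess) hX'.2.2
  have hYC : Y * Yᵀ ∈ CC A b :=
    ⟨by rw [IsSymm, transpose_mul, transpose_transpose], hY,
      by simpa using posSemidef_self_mul_conjTranspose Y⟩
  have hgradY : 2 * trace (Smat A C Y * (Y * Yᵀ)) ≤ εg * Real.sqrt R := by
    calc 2 * trace (Smat A C Y * (Y * Yᵀ)) = ip (2 • (Smat A C Y * Y)) Y := by
          rw [ip, ← trace_transpose (_ᵀ * Y), transpose_mul, transpose_transpose, trace_mul_comm Yᵀ,
            smul_mul, trace_smul, Matrix.mul_assoc, nsmul_eq_mul, Nat.cast_ofNat]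
      _ ≤ frob (2 • (Smat A C Y * Y)) * frob Y := ip_le_frob_mul_frob _ _
      _ ≤ εg * Real.sqrt R := by
          rw [frob_eq_sqrt_trace Y]
          exact mul_le_mul hgrad (Real.sqrt_le_sqrt (hRC _ hYC)) (Real.sqrt_nonneg _) hεg
  have hadj := trace_mul_eq_of_calA_eq (hYC.2.1.trans hX'.2.1.symm)
    ((gram A Y)⁻¹ *ᵥ calA A (C * (Y * Yᵀ)))
  have hR' := mul_le_mul_of_nonneg_left (hRC X' hX') hεH
  rw [hC.eq]
  simp only [Smat, Matrix.sub_mul, trace_sub] at hpsd hgradY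
  linarith
end
end
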